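/- Let G be a finite nonabelian group such that every proper subgroup of G is abelian and every quotient of G by a nontrivial normal subgroup is abelian. Then G is monomial. -/

import Mathlib

open Classical

open CategoryTheory

/-- The function on `G` induced from a function `f` on a subgroup `H`, given by the usual
induced-character formula `Ind_H^G f (g) = |H|⁻¹ * ∑_{x ∈ G, x g x⁻¹ ∈ H} f (x g x⁻¹)`. -/
noncomputable def inducedCharFun {G : Type*} [Group G] [Fintype G]
    (H : Subgroup G) (f : H → ℂ) : G → ℂ := fun g =>
  (Nat.card H : ℂ)⁻¹ * ∑ x : G, if h : x * g * x⁻¹ ∈ H then f ⟨x * g * x⁻¹, h⟩ else 0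

/-- A finite group is monomial if each of its irreducible finite-dimensional complex
representations is isomorphic to a representation induced from a one-dimensional
representation of some subgroup; since complex representations of finite groups are
determined up to isomorphism by their characters, this is expressed by saying that the
character of each irreducible representation is the character induced from a
one-dimensional character `ψ : H →* ℂˣ` of some subgroup `H`. -/
def IsMonomial (G : Type) [Group G] [Fintype G] : Prop :=
  ∀ V : FDRep ℂ G, Simple V → ∃ (H : Subgroup G) (ψ : H →* ℂˣ),
    ∀ g : G, V.character g = inducedCharFun H (fun h => (ψ h : ℂ)) g

open Module in
/-- Commuting endomorphisms of a nonzero finite-dimensional space have a common eigenvector. -/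
theorem exists_common_eigenvector {K V ι : Type*} [Field K] [IsAlgClosed K] [AddCommGroup V]
    [Module K V] [FiniteDimensional K V] [Nontrivial V] (f : ι → End K V)
    (hf : ∀ i j, Commute (f i) (f j)) : ∃ v ≠ 0, ∀ i, ∃ c : K, f i v = c • v := by
  obtain ⟨W, ⟨hW, hinv⟩, hmin⟩ := exists_minimal_of_wellFoundedLT
    (fun W : Submodule K V => W ≠ ⊥ ∧ ∀ i, ∀ w ∈ W, f i w ∈ W) ⟨⊤, top_ne_bot, by simp⟩
  obtain ⟨v, hvW, hv⟩ := W.ne_bot_iff.mp hW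
  refine ⟨v, hv, fun i => ?_⟩
  have : Nontrivial W := (Submodule.nontrivial_iff_ne_bot).mpr hW
  obtain ⟨c, hc⟩ := End.exists_eigenvalue ((f i).restrict (hinv i))
  obtain ⟨w, hw, hw0⟩ := hc.exists_hasEigenvector
  have hw' : f i w = c • (w : V) := by
    simpa using congrArg Subtype.val (End.mem_eigenspace_iff.mp hw)
  have hle := hmin (y := W ⊓ End.eigenspace (f i) c) ⟨?_, ?_⟩ inf_le_left hvW
  · exact ⟨c, End.mem_eigenspace_iff.mp hle.2⟩
  · exact (Submodule.ne_bot_iff _).mpr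
      ⟨w, ⟨w.2, End.mem_eigenspace_iff.mpr hw'⟩, by simpa using hw0⟩
  · rintro j x ⟨hx, hxc⟩
    refine ⟨hinv j x hx, End.mem_eigenspace_iff.mpr ?_⟩
    have := LinearMap.congr_fun (hf i j).eq x
    simp only [End.mul_apply] at this
    rw [this, End.mem_eigenspace_iff.mp hxc, map_smul]

/-- A common eigenvector of a group representation affords a linear character. -/
theorem Representation.exists_character_of_eigenvector {K V H : Type*} [Field K] [Group H]
    [AddCommGroup V] [Module K V] (ρ : Representation K H V) {v : V} (hv : v ≠ 0)
    (h : ∀ x, ∃ c : K, ρ x v = c • v) :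
    ∃ ψ : H →* Kˣ, ∀ x, ρ x v = (ψ x : K) • v := by
  choose c hc using h
  let φ : H →* K :=
    { toFun := c
      map_one' := smul_left_injective K hv (by simp [← hc])
      map_mul' := fun x y => smul_left_injective K hv (by
        simp only [← hc, map_mul, Module.End.mul_apply]
        rw [hc y, map_smul, hc x, smul_smul, mul_comm]) }
  exact ⟨φ.toHomUnits, fun x => hc x⟩

/-- The elements of a group acting on a given vector by a nonzero scalar. -/
def Representation.scalarStabilizer {K V G : Type*} [Field K] [Group G] [AddCommGroup V]
    [Module K V] (ρ : Representation K G V) (v : V) : Subgroup G where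
  carrier := {x | ∃ c : Kˣ, ρ x v = (c : K) • v}
  one_mem' := ⟨1, by simp⟩
  mul_mem' := by
    rintro x y ⟨c, hc⟩ ⟨d, hd⟩
    refine ⟨c * d, ?_⟩
    rw [map_mul, Module.End.mul_apply, hd, map_smul, hc, smul_smul, mul_comm, Units.val_mul]
  inv_mem' := by
    rintro x ⟨c, hc⟩
    refine ⟨c⁻¹, ?_⟩
    have h : ρ x⁻¹ (ρ x v) = v := by
      rw [← Module.End.mul_apply, ← map_mul, inv_mul_cancel, map_one, Module.End.one_apply]
    rw [hc, map_smul] at h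
    nth_rewrite 2 [← h]
    simp [smul_smul]

/-- Nonzero simultaneous eigenvectors with distinct linear characters are linearly independent. -/
theorem linearIndependent_of_injective_characters {K V H ι : Type*} [Field K] [Monoid H]
    [AddCommGroup V] [Module K V] (ρ : Representation K H V) (χ : ι → H →* K)
    (hχ : Function.Injective χ) (b : ι → V) (hb : ∀ i, b i ≠ 0)
    (h : ∀ i x, ρ x (b i) = χ i x • b i) : LinearIndependent K b := by
  rw [linearIndependent_iff']
  intro s c hc i hi
  have key : c i • b i = 0 := by
    rw [← Module.forall_dual_apply_eq_zero_iff K]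
    intro f
    have hli := (linearIndependent_monoidHom H K).comp χ hχ
    rw [linearIndependent_iff'] at hli
    have := hli s (fun j => f (c j • b j)) (by
      ext x
      have := congrArg (fun w => f (ρ x w)) hc
      simpa [h, mul_comm, mul_left_comm, mul_assoc] using this) i hi
    exact this
  exact (smul_eq_zero.mp key).resolve_right (hb i)

/-- The space underlying a simple object of `FDRep` is nonzero. -/
theorem FDRep.nontrivial_of_simple {K : Type} {G : Type} [Field K] [Group G] (V : FDRep K G)
    [Simple V] : Nontrivial V := by
  by_contra hV
  rw [not_nontrivial_iff_subsingleton] at hV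
  refine id_nonzero V ?_
  ext x
  exact Subsingleton.elim _ _

/-- A representation attached to a simple object of `FDRep` is irreducible. -/
theorem FDRep.isIrreducible_of_simple {K : Type} {G : Type} [Field K] [Group G] (V : FDRep K G)
    [Simple V] : Representation.IsIrreducible V.ρ := by
  have hnt : Nontrivial V := V.nontrivial_of_simple
  have : Nontrivial (Subrepresentation V.ρ) := by
    refine ⟨⊥, ⊤, fun h => ?_⟩
    obtain ⟨x, hx⟩ := exists_ne (0 : V)
    have hx' : x ∈ (⊤ : Subrepresentation V.ρ) := trivial
    rw [← h] at hx'
    exact hx hx'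
  refine ⟨fun W => ?_⟩
  let i : FDRep.of W.toRepresentation ⟶ V :=
    ⟨FGModuleCat.ofHom W.toSubmodule.subtype, fun g => by ext x; rfl⟩
  have : Mono i := by
    refine (forget (FDRep K G)).mono_of_mono_map ?_
    rw [mono_iff_injective]
    exact Subtype.val_injective
  by_cases hi : i = 0
  · left
    apply Subrepresentation.toSubmodule_injective
    refine (Submodule.eq_bot_iff _).mpr fun x hx => ?_
    have := congrArg (fun f => f.hom.hom.hom (⟨x, hx⟩ : W.toSubmodule)) hi
    exact this
  · right
    have := isIso_of_mono_of_nonzero hi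
    apply Subrepresentation.toSubmodule_injective
    refine (Submodule.eq_top_iff'.mpr fun x => ?_)
    have := ConcreteCategory.congr_hom (IsIso.inv_hom_id i) x
    have h2 : ((inv i).hom.hom.hom x : W.toSubmodule).1 = x := this
    rw [← h2]
    exact Subtype.prop _

section Induced

variable {G : Type*} [Group G] {H : Subgroup G} [H.Normal]

/-- The induced-character formula as a sum over the cosets of a normal subgroup. -/
theorem inducedCharFun_eq_sum_quotient [Fintype G] (ψ : H →* ℂˣ) (g : G) :
    inducedCharFun H (fun h => (ψ h : ℂ)) g = ∑ q : G ⧸ H,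
      if h : g ∈ H then (ψ (MulAut.conjNormal q.out⁻¹ ⟨g, h⟩) : ℂ) else 0 := by
  unfold inducedCharFun
  by_cases hg : g ∈ H
  · have hmem (x : G) : x * g * x⁻¹ ∈ H := ‹H.Normal›.conj_mem g hg x
    have hF (x : G) : (ψ ⟨x⁻¹ * g * x⁻¹⁻¹, hmem _⟩ : ℂ) =
        ψ (MulAut.conjNormal (x : G ⧸ H).out⁻¹ ⟨g, hg⟩) := by
      obtain ⟨h, hh⟩ := QuotientGroup.mk_out_eq_mul H x
      have : (MulAut.conjNormal (x : G ⧸ H).out⁻¹ ⟨g, hg⟩ : H) =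
          h⁻¹ * ⟨x⁻¹ * g * x⁻¹⁻¹, hmem _⟩ * h := by
        ext
        simp [hh, mul_assoc]
      rw [this, map_mul, map_mul, mul_right_comm, ← map_mul, inv_mul_cancel, map_one, one_mul]
    simp only [hmem, hg, dite_true]
    rw [← Equiv.sum_comp (Equiv.inv G)]
    simp only [Equiv.inv_apply, hF]
    have := Equiv.sum_comp (Subgroup.groupEquivQuotientProdSubgroup (s := H))
      (fun p => (ψ (MulAut.conjNormal p.1.out⁻¹ ⟨g, hg⟩) : ℂ))
    rw [Fintype.sum_prod_type] at this
    simp only [Finset.sum_const, Finset.card_univ, nsmul_eq_mul, ← Finset.mul_sum] at this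
    rw [← Nat.card_eq_fintype_card] at this
    rw [inv_mul_eq_iff_eq_mul₀ (by exact_mod_cast Nat.card_pos.ne'), ← this]
    rfl
  · have hmem (x : G) : x * g * x⁻¹ ∉ H := fun h => hg (by
      simpa [mul_assoc] using ‹H.Normal›.conj_mem _ h x⁻¹)
    simp [hmem, hg]

/-- Translating an `H`-eigenvector by `x` conjugates its linear character. -/
theorem Representation.apply_apply_of_eigenvector {K V : Type*} [Field K] [AddCommGroup V]
    [Module K V] (ρ : Representation K G V) (ψ : H →* Kˣ) {v : V}
    (hψ : ∀ h : H, ρ h v = (ψ h : K) • v) (x : G) (h : H) :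
    ρ h (ρ x v) = (ψ (MulAut.conjNormal x⁻¹ h) : K) • ρ x v := by
  rw [← map_smul, ← hψ, ← Module.End.mul_apply, ← Module.End.mul_apply, ← map_mul, ← map_mul]
  simp [mul_assoc]

/-- If an irreducible representation contains an eigenvector for a normal subgroup `H` whose linear
character has inertia group `H`, then its character is induced from that linear character. -/
theorem Representation.character_eq_inducedCharFun [Fintype G] {V : Type*} [AddCommGroup V]
    [Module ℂ V] [FiniteDimensional ℂ V] (ρ : Representation ℂ G V) [ρ.IsIrreducible]
    (ψ : H →* ℂˣ) {v : V} (hv : v ≠ 0) (hψ : ∀ h : H, ρ h v = (ψ h : ℂ) • v)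
    (hinertia : ∀ g : G, (∀ h : H, ψ (MulAut.conjNormal g⁻¹ h) = ψ h) → g ∈ H) (g : G) :
    ρ.character g = inducedCharFun H (fun h => (ψ h : ℂ)) g := by
  let b : G ⧸ H → V := fun q => ρ q.out v
  have hb0 (q : G ⧸ H) : b q ≠ 0 := fun h0 => hv (by
    have := congrArg (ρ q.out⁻¹) h0
    rwa [map_zero, ← Module.End.mul_apply, ← map_mul, inv_mul_cancel, map_one] at this)
  have hperm (x : G) (q : G ⧸ H) : ∃ c : ℂ, ρ x (b q) = c • b (x • q) := by
    obtain ⟨h, hh⟩ := QuotientGroup.mk_out_eq_mul H (x * q.out)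
    have hq : ((x * q.out : G) : G ⧸ H) = x • q := by
      conv_rhs => rw [← QuotientGroup.out_eq' q]
      rfl
    rw [hq] at hh
    refine ⟨(ψ h⁻¹ : ℂ), ?_⟩
    have hx : x * q.out = (x • q).out * (h⁻¹ : H) := by simp [hh]
    simp only [b]
    rw [← Module.End.mul_apply, ← map_mul, hx, map_mul, Module.End.mul_apply, hψ, map_smul]
  let χ : G ⧸ H → H →* ℂ := fun q =>
    (Units.coeHom ℂ).comp (ψ.comp (MulAut.conjNormal q.out⁻¹).toMonoidHom)
  have hχ : Function.Injective χ := by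
    intro q r hqr
    have h1 (h : H) : ψ (MulAut.conjNormal q.out⁻¹ h) = ψ (MulAut.conjNormal r.out⁻¹ h) :=
      Units.ext (DFunLike.congr_fun hqr h)
    rw [← QuotientGroup.out_eq' q, ← QuotientGroup.out_eq' r]
    refine QuotientGroup.eq.mpr (hinertia _ fun h => ?_)
    have h2 := (h1 (MulAut.conjNormal q.out h)).symm
    simp only [← MulAut.mul_apply, ← map_mul] at h2
    simpa using h2
  have hli : LinearIndependent ℂ b :=
    linearIndependent_of_injective_characters (ρ.comp H.subtype) χ hχ b hb0
      fun q h => ρ.apply_apply_of_eigenvector ψ hψ q.out h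
  let S : Subrepresentation ρ := ⟨Submodule.span ℂ (Set.range b), fun x w hw => by
    have : Submodule.span ℂ (Set.range b) ≤ (Submodule.span ℂ (Set.range b)).comap (ρ x) := by
      rw [Submodule.span_le]
      rintro _ ⟨q, rfl⟩
      obtain ⟨c, hc⟩ := hperm x q
      rw [SetLike.mem_coe, Submodule.mem_comap, hc]
      exact Submodule.smul_mem _ _ (Submodule.subset_span ⟨_, rfl⟩)
    exact this hw⟩
  have hS : S = ⊤ := (eq_bot_or_eq_top S).resolve_left fun h => by
    have hmem : b (1 : G) ∈ S := Submodule.subset_span ⟨_, rfl⟩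
    rw [h] at hmem
    exact hb0 _ hmem
  have hspan : ⊤ ≤ Submodule.span ℂ (Set.range b) :=
    (congrArg Subrepresentation.toSubmodule hS).ge
  let B := Module.Basis.mk hli hspan
  have hB (q : G ⧸ H) : B q = b q := Module.Basis.mk_apply hli hspan q
  rw [inducedCharFun_eq_sum_quotient, Representation.character, LinearMap.trace_eq_matrix_trace ℂ B,
    Matrix.trace]
  refine Finset.sum_congr rfl fun q _ => ?_
  rw [Matrix.diag_apply, LinearMap.toMatrix_apply, hB]
  split_ifs with hg
  · rw [ρ.apply_apply_of_eigenvector ψ hψ q.out ⟨g, hg⟩, map_smul, ← show B q = ρ q.out v from hB q]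
    simp
  · obtain ⟨c, hc⟩ := hperm g q
    have hne : g • q ≠ q := fun h => hg (by
      obtain ⟨x, rfl⟩ := QuotientGroup.mk_surjective q
      have : x⁻¹ * (g * x) ∈ H := QuotientGroup.eq.mp h.symm
      simpa [mul_assoc] using ‹H.Normal›.conj_mem _ this x)
    rw [hc, ← hB]
    simp [hne]

end Induced

/-- A finite nonabelian group all of whose proper subgroups are abelian is not simple. -/
theorem exists_normal_ne_bot_ne_top_of_proper_subgroups_abelian {G : Type*} [Group G] [Finite G]
    (hna : ¬ ∀ a b : G, a * b = b * a)
    (hsub : ∀ H : Subgroup G, H ≠ ⊤ → ∀ a b : H, a * b = b * a) :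
    ∃ N : Subgroup G, N.Normal ∧ N ≠ ⊥ ∧ N ≠ ⊤ := by
  have hnt : Nontrivial G := by
    by_contra h
    rw [not_nontrivial_iff_subsingleton] at h
    exact hna fun a b => Subsingleton.elim _ _
  obtain ⟨p, hp, hpG⟩ := Nat.exists_prime_and_dvd (Finite.one_lt_card (α := G)).ne'
  have := Fact.mk hp
  let P : Sylow p G := default
  have hP : (P : Subgroup G) ≠ ⊥ := P.ne_bot_of_dvd_card hpG
  by_cases hPtop : (P : Subgroup G) = ⊤
  · have hpG : IsPGroup p G := by
      have := P.isPGroup'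
      rw [hPtop] at this
      exact this.of_equiv Subgroup.topEquiv
    refine ⟨Subgroup.center G, inferInstance, ?_, fun h => hna fun a b => ?_⟩
    · have := hpG.center_nontrivial
      exact (Subgroup.nontrivial_iff_ne_bot _).mp this
    · exact (Subgroup.mem_center_iff.mp (h ▸ Subgroup.mem_top b : b ∈ Subgroup.center G) a)
  · by_cases hN : Subgroup.normalizer (P : Set G) = ⊤
    · exact ⟨P, Subgroup.normalizer_eq_top_iff.mp hN, hP, hPtop⟩
    · have hle : Subgroup.normalizer (P : Set G) ≤ Subgroup.centralizer (P : Set G) := by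
        intro x hx
        rw [Subgroup.mem_centralizer_iff]
        intro y hy
        exact congrArg Subtype.val (hsub _ hN ⟨y, Subgroup.le_normalizer hy⟩ ⟨x, hx⟩)
      have hc := MonoidHom.ker_transferSylow_isComplement' P hle
      refine ⟨(MonoidHom.transferSylow P hle).ker, inferInstance, fun h => hPtop ?_, fun h => hP ?_⟩
      · rw [h] at hc
        exact Subgroup.isComplement'_bot_left.mp hc
      · rw [h] at hc
        exact Subgroup.isComplement'_top_left.mp hc

/-- A finite nonabelian group all of whose proper subgroups are abelian and all of whose
quotients by nontrivial normal subgroups are abelian (the quotient `G/N` being abelian is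
expressed by all commutators lying in `N`) is monomial. -/
theorem isMonomial_of_proper_subgroups_and_quotients_abelian
    (G : Type) [Group G] [Fintype G]
    (hna : ¬ ∀ a b : G, a * b = b * a)
    (hsub : ∀ H : Subgroup G, H ≠ ⊤ → ∀ a b : H, a * b = b * a)
    (hquot : ∀ N : Subgroup G, N.Normal → N ≠ ⊥ → ∀ a b : G, a * b * a⁻¹ * b⁻¹ ∈ N) :
    IsMonomial G := by
  intro V hV
  have hirr := FDRep.isIrreducible_of_simple V
  obtain ⟨N, hN, hNbot, hNtop⟩ :=
    exists_normal_ne_bot_ne_top_of_proper_subgroups_abelian hna hsub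
  obtain ⟨M, hM, hNM⟩ := (eq_top_or_exists_le_coatom N).resolve_left hNtop
  have hMn : M.Normal := ⟨fun n hn g => by
    simpa using M.mul_mem (hNM (hquot N hN hNbot g n)) hn⟩
  have hnt : Nontrivial V := V.nontrivial_of_simple
  have hcomm (h k : M) : Commute (V.ρ h) (V.ρ k) := by
    rw [Commute, SemiconjBy, ← map_mul, ← map_mul]
    exact congrArg _ (congrArg Subtype.val (hsub M hM.1 h k))
  obtain ⟨v, hv, hev⟩ := exists_common_eigenvector (fun h : M => V.ρ h) hcomm
  obtain ⟨ψ, hψ⟩ :=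
    Representation.exists_character_of_eigenvector (V.ρ.comp M.subtype) hv hev
  by_cases hin : ∀ g : G, (∀ h : M, ψ (MulAut.conjNormal g⁻¹ h) = ψ h) → g ∈ M
  · exact ⟨M, ψ, fun g => Representation.character_eq_inducedCharFun V.ρ ψ hv hψ hin g⟩
  push Not at hin
  obtain ⟨t, ht, htM⟩ := hin
  have hMt : M ⊔ Subgroup.zpowers t = ⊤ :=
    hM.2 _ (left_lt_sup.mpr fun h => htM (h (Subgroup.mem_zpowers t)))
  let E : Submodule ℂ V :=
    ⨅ h : M, Module.End.eigenspace (V.ρ h) (ψ h : ℂ)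
  have hE (w : V) : w ∈ E ↔ ∀ h : M, V.ρ h w = (ψ h : ℂ) • w := by
    simp only [E, Submodule.mem_iInf, Module.End.mem_eigenspace_iff]
  have hEt (w : V) (hw : w ∈ E) : V.ρ t w ∈ E := (hE _).mpr fun h => by
    rw [Representation.apply_apply_of_eigenvector V.ρ ψ ((hE w).mp hw) t h, ht]
  have hEnt : Nontrivial E :=
    Submodule.nontrivial_iff_ne_bot.mpr (E.ne_bot_iff.mpr ⟨v, (hE v).mpr hψ, hv⟩)
  obtain ⟨c, hc⟩ := Module.End.exists_eigenvalue ((V.ρ t).restrict hEt)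
  obtain ⟨w, hw, hw0⟩ := hc.exists_hasEigenvector
  have hwt : V.ρ t w = c • (w : V) := by
    simpa using congrArg Subtype.val (Module.End.mem_eigenspace_iff.mp hw)
  have hw0' : (w : V) ≠ 0 := by simpa using hw0
  have hc0 : c ≠ 0 := by
    rintro rfl
    have := congrArg (V.ρ t⁻¹) hwt
    rw [← Module.End.mul_apply, ← map_mul] at this
    exact hw0' (by simpa using this)
  have htop : Representation.scalarStabilizer V.ρ (w : V) = ⊤ :=
    top_le_iff.mp (hMt ▸ sup_le (fun m hm => ⟨ψ ⟨m, hm⟩, (hE w).mp w.2 ⟨m, hm⟩⟩)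
      (Subgroup.zpowers_le.mpr ⟨Units.mk0 c hc0, hwt⟩))
  obtain ⟨φ, hφ⟩ := Representation.exists_character_of_eigenvector
    (V.ρ.comp (⊤ : Subgroup G).subtype) hw0' fun x => by
      obtain ⟨d, hd⟩ : (x : G) ∈ Representation.scalarStabilizer V.ρ (w : V) := by
        simp [htop]
      exact ⟨d, hd⟩
  exact ⟨⊤, φ, fun g =>
    Representation.character_eq_inducedCharFun V.ρ φ hw0' hφ (fun _ _ => trivial) g⟩
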